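/- (Uniqueness of magnitude retrieval.) Let x, y : ℕᵈ → ℂ be nonzero finitely supported sequences with generating polynomials X, Y ∈ ℂ[w₁,…,w_d]. Assume that neither X nor Y has any non-unit divisor that is conjugate symmetric (in particular no monomial factor, i.e. trivial linear phase factors are excluded). If X(ω)·conj(Y(ω)) ∈ ℝ for all ω ∈ ℝᵈ (equivalently, the tangents of the phases of the Fourier transforms of x and y agree wherever defined), then there exists a real number β such that x(n) = β·y(n) for all n. -/

import Mathlib

/-!
STATEMENT 2: Uniqueness of magnitude retrieval.
A finitely supported sequence `x : ℕᵈ → ℂ` is identified with the coefficient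
function of its generating polynomial `X = Σₙ x(n)·wⁿ ∈ ℂ[w₁,…,w_d]`.
The Fourier transform is the evaluation of `X` at `wⱼ = exp(−2πiωⱼ)`.
-/

/-- The coefficient sequence of a polynomial, extended by zero to `ℤᵈ`. -/
noncomputable def coeffZ {d : ℕ} (P : MvPolynomial (Fin d) ℂ) (n : Fin d → ℤ) : ℂ :=
  if ∀ j, 0 ≤ n j then
    MvPolynomial.coeff (Finsupp.equivFunOnFinite.symm fun j => (n j).toNat) P
  else 0

/-- A polynomial `P = Σₙ pₙ·wⁿ` is conjugate symmetric if there are `k ∈ ℕᵈ` and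
`ε ∈ {1,−1}` with `pₙ = ε·conj(p_{k−n})` for all `n ∈ ℤᵈ` (coefficients vanishing
outside the support). -/
def ConjSymmetric {d : ℕ} (P : MvPolynomial (Fin d) ℂ) : Prop :=
  ∃ (k : Fin d → ℕ) (ε : ℝ), (ε = 1 ∨ ε = -1) ∧
    ∀ n : Fin d → ℤ,
      coeffZ P n = (ε : ℂ) * (starRingEnd ℂ) (coeffZ P fun j => (k j : ℤ) - n j)

open MvPolynomial

/-- Coefficients outside the box `[0, k]` vanish, in terms of `coeffZ`. -/
theorem coeffZ_eq_zero_of_lt {d : ℕ} {P : MvPolynomial (Fin d) ℂ} {k : Fin d →₀ ℕ}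
    (hs : ∀ m, coeff m P ≠ 0 → m ≤ k) {n : Fin d → ℤ} {j : Fin d} (hj : (k j : ℤ) < n j) :
    coeffZ P n = 0 := by
  unfold coeffZ
  split_ifs with h
  · by_contra hne
    have h1 : (n j).toNat ≤ k j := by simpa using hs _ hne j
    have h2 := h j
    omega
  · rfl

theorem coeffZ_eq_zero_of_neg {d : ℕ} (P : MvPolynomial (Fin d) ℂ) {n : Fin d → ℤ} {j : Fin d}
    (hj : n j < 0) : coeffZ P n = 0 :=
  if_neg fun h => (h j).not_gt hj

theorem conjSymmetric_of_coeff {d : ℕ} {P : MvPolynomial (Fin d) ℂ} {k : Fin d →₀ ℕ} {ε : ℝ}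
    (hε : ε = 1 ∨ ε = -1) (hs : ∀ m, coeff m P ≠ 0 → m ≤ k)
    (h : ∀ m n, m + n = k → coeff m P = (ε : ℂ) * (starRingEnd ℂ) (coeff n P)) :
    ConjSymmetric P := by
  refine ⟨k, ε, hε, fun n => ?_⟩
  by_cases hn : ∀ j, 0 ≤ n j ∧ n j ≤ k j
  · unfold coeffZ
    rw [if_pos fun j => (hn j).1, if_pos fun j => sub_nonneg.2 (hn j).2]
    apply h
    ext j
    have := hn j
    simp
    omega
  · push Not at hn
    obtain ⟨j, hj⟩ := hn
    rcases lt_or_ge (n j) 0 with hneg | hpos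
    · rw [coeffZ_eq_zero_of_neg P hneg, coeffZ_eq_zero_of_lt hs (j := j) (by omega)]
      simp
    · have := hj hpos
      rw [coeffZ_eq_zero_of_lt hs this, coeffZ_eq_zero_of_neg P (j := j) (by omega)]
      simp

theorem conjSymmetric_X {d : ℕ} (i : Fin d) : ConjSymmetric (X i : MvPolynomial (Fin d) ℂ) := by
  classical
  refine conjSymmetric_of_coeff (k := Finsupp.single i 1 + Finsupp.single i 1) (Or.inl rfl)
    (fun m hm => ?_) fun m n hmn => ?_
  · rw [coeff_X] at hm
    have : Finsupp.single i 1 = m := by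
      by_contra h
      exact hm (if_neg h)
    rw [← this]
    exact le_self_add
  · have : Finsupp.single i 1 = m ↔ Finsupp.single i 1 = n := by
      constructor
      · rintro rfl
        exact (add_left_cancel hmn).symm
      · rintro rfl
        exact (add_right_cancel hmn).symm
    rw [coeff_X, coeff_X]
    simp only [this]
    split_ifs <;> simp

/-- The vector of partial degrees of a polynomial. -/
noncomputable def multidegree {d : ℕ} (P : MvPolynomial (Fin d) ℂ) : Fin d →₀ ℕ :=
  Finsupp.equivFunOnFinite.symm fun j => degreeOf j P

theorem le_multidegree {d : ℕ} {P : MvPolynomial (Fin d) ℂ} {m : Fin d →₀ ℕ}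
    (hm : m ∈ P.support) : m ≤ multidegree P :=
  fun j => monomial_le_degreeOf j hm

/-- The conjugate reflection `w ^ k * conj P (1 / conj w)`, where `k` is the multidegree of `P`. -/
noncomputable def conjReflect {d : ℕ} (P : MvPolynomial (Fin d) ℂ) : MvPolynomial (Fin d) ℂ :=
  ∑ n ∈ P.support, monomial (multidegree P - n) ((starRingEnd ℂ) (coeff n P))

theorem coeff_conjReflect {d : ℕ} {P : MvPolynomial (Fin d) ℂ} {m n : Fin d →₀ ℕ}
    (h : m + n = multidegree P) : coeff m (conjReflect P) = (starRingEnd ℂ) (coeff n P) := by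
  classical
  rw [conjReflect, coeff_sum, Finset.sum_eq_single n]
  · rw [coeff_monomial, if_pos (by rw [← h, add_tsub_cancel_right])]
  · intro l hl hln
    rw [coeff_monomial, if_neg]
    rintro rfl
    refine hln (add_left_cancel (a := multidegree P - l) ?_)
    rw [h, tsub_add_cancel_of_le (le_multidegree hl)]
  · intro hn
    rw [notMem_support_iff.1 hn]
    simp

theorem degreeOf_conjReflect_le {d : ℕ} (P : MvPolynomial (Fin d) ℂ) (j : Fin d) :
    degreeOf j (conjReflect P) ≤ degreeOf j P := by
  refine (degreeOf_sum_le j _ _).trans (Finset.sup_le fun n hn => ?_)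
  rw [degreeOf_monomial_eq _ _ (by simpa using hn)]
  exact Nat.sub_le _ _

theorem conjReflect_ne_zero {d : ℕ} {P : MvPolynomial (Fin d) ℂ} (hP : P ≠ 0) :
    conjReflect P ≠ 0 := by
  obtain ⟨n, hn⟩ := support_nonempty.2 hP
  refine ne_zero_iff.2 ⟨multidegree P - n, ?_⟩
  rw [coeff_conjReflect (tsub_add_cancel_of_le (le_multidegree hn))]
  simpa using hn

theorem eval_conjReflect {d : ℕ} (P : MvPolynomial (Fin d) ℂ) {w : Fin d → ℂ}
    (hw : ∀ j, ‖w j‖ = 1) :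
    eval w (conjReflect P) =
      eval w (monomial (multidegree P) 1) * (starRingEnd ℂ) (eval w P) := by
  have hinv : ∀ j, w j * (starRingEnd ℂ) (w j) = 1 := fun j => by
    rw [Complex.mul_conj']; simp [hw j]
  conv_rhs => rw [eval_eq' w P]
  rw [conjReflect, map_sum, map_sum, Finset.mul_sum]
  refine Finset.sum_congr rfl fun n hn => ?_
  have hle := le_multidegree hn
  simp only [eval_monomial, Finsupp.prod_fintype _ _ (fun _ => pow_zero _), map_mul, map_prod,
    map_pow, one_mul]
  rw [mul_left_comm, ← Finset.prod_mul_distrib]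
  congr 1
  refine Finset.prod_congr rfl fun j _ => ?_
  rw [← tsub_add_cancel_of_le (hle j), pow_add, mul_assoc, ← mul_pow, hinv, one_pow, mul_one]
  simp

/-- Polynomials agreeing on the torus are equal. -/
theorem eq_of_eval_torus_eq {d : ℕ} {P Q : MvPolynomial (Fin d) ℂ}
    (h : ∀ w : Fin d → ℂ, (∀ j, ‖w j‖ = 1) → eval w P = eval w Q) : P = Q := by
  have hinf : (Metric.sphere (0 : ℂ) 1).Infinite := by
    refine IsPreconnected.infinite_of_nontrivial ?_ ⟨1, by simp, -1, by simp, by norm_num⟩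
    exact isPreconnected_sphere (by simp [Complex.rank_real_complex]) _ _
  refine funext_set (fun _ => Metric.sphere (0 : ℂ) 1) (fun _ => hinf) fun w hw => h w fun j => ?_
  simpa using hw j (Set.mem_univ j)

theorem exists_exp_eq_of_norm_eq_one {z : ℂ} (hz : ‖z‖ = 1) :
    ∃ t : ℝ, Complex.exp (-(2 * Real.pi * Complex.I) * (t : ℂ)) = z := by
  refine ⟨-(Complex.arg z) / (2 * Real.pi), ?_⟩
  have h := Complex.norm_mul_exp_arg_mul_I z
  rw [hz, Complex.ofReal_one, one_mul] at h
  conv_rhs => rw [← h]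
  congr 1
  have : (Real.pi : ℂ) ≠ 0 := by exact_mod_cast Real.pi_ne_zero
  push_cast
  field_simp

/-- A polynomial whose divisors `X i` are excluded is coprime to every monomial. -/
theorem isRelPrime_monomial {d : ℕ} {A : MvPolynomial (Fin d) ℂ} (hA : ∀ i, ¬ X i ∣ A)
    (k : Fin d →₀ ℕ) : IsRelPrime A (monomial k 1) := by
  rw [monomial_eq, C_1, one_mul, Finsupp.prod]
  refine IsRelPrime.prod_right fun i _ => IsRelPrime.pow_right fun D hDA hDX => ?_
  obtain ⟨E, hE⟩ := hDX
  rcases (X_prime (R := ℂ) (i := i)).irreducible.isUnit_or_isUnit hE with hD | hu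
  · exact hD
  · exact absurd ((hE ▸ (hu.mul_right_dvd.2 dvd_rfl)).trans hDA) (hA i)

/-- If `A` divides its conjugate reflection, some scalar multiple of `A` is conjugate symmetric. -/
theorem exists_conjSymmetric_of_dvd_conjReflect {d : ℕ} {A : MvPolynomial (Fin d) ℂ} (hA : A ≠ 0)
    (h : A ∣ conjReflect A) : ∃ u : ℂ, u ≠ 0 ∧ ConjSymmetric (C u * A) := by
  obtain ⟨Q, hQ⟩ := h
  have hQ0 : Q ≠ 0 := by
    rintro rfl
    exact conjReflect_ne_zero hA (by simpa using hQ)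
  have hdeg : ∀ j, degreeOf j Q = 0 := fun j => by
    have := degreeOf_conjReflect_le A j
    rw [hQ, degreeOf_mul_eq hA hQ0] at this
    omega
  obtain ⟨c, rfl⟩ : ∃ c, Q = C c := by
    refine ⟨coeff 0 Q, totalDegree_eq_zero_iff_eq_C.1 ?_⟩
    refine (totalDegree_eq_zero_iff _ _).2 fun m hm j => ?_
    exact Nat.le_zero.1 ((monomial_le_degreeOf j hm).trans (hdeg j).le)
  have hrel : ∀ m n, m + n = multidegree A →
      (starRingEnd ℂ) (coeff n A) = coeff m A * c := fun m n hmn => by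
    rw [← coeff_conjReflect hmn, hQ, mul_comm A, coeff_C_mul, mul_comm]
  have hc : c * (starRingEnd ℂ) c = 1 := by
    obtain ⟨n, hn⟩ := support_nonempty.2 hA
    have hmn := tsub_add_cancel_of_le (le_multidegree hn)
    have h1 := hrel _ _ hmn
    have h2 := hrel _ _ ((add_comm _ _).trans hmn)
    have h3 := congrArg (starRingEnd ℂ) h1
    rw [map_mul, h2, Complex.conj_conj] at h3
    refine mul_left_cancel₀ (mem_support_iff.1 hn) ?_
    rw [← mul_assoc, ← h3, mul_one]
  have hs : ∀ u m, coeff m (C u * A) ≠ 0 → m ≤ multidegree A := fun u m hm => by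
    rw [coeff_C_mul] at hm
    exact le_multidegree (mem_support_iff.2 (right_ne_zero_of_mul hm))
  by_cases hc1 : c = -1
  · refine ⟨1, one_ne_zero, conjSymmetric_of_coeff (ε := -1) (Or.inr rfl) (hs 1) fun m n hmn => ?_⟩
    rw [C_1, one_mul, hrel m n hmn, hc1]
    push_cast
    ring
  · refine ⟨1 + c, fun h => hc1 (eq_neg_of_add_eq_zero_right h),
      conjSymmetric_of_coeff (ε := 1) (Or.inl rfl) (hs _) fun m n hmn => ?_⟩
    rw [coeff_C_mul, coeff_C_mul, map_mul, hrel m n hmn, map_add, map_one]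
    push_cast
    linear_combination (-coeff m A) * hc

theorem isUnit_of_dvd_conjReflect {d : ℕ} {A P : MvPolynomial (Fin d) ℂ} (hA : A ≠ 0)
    (hAP : A ∣ P) (hP : ∀ D : MvPolynomial (Fin d) ℂ, D ∣ P → ConjSymmetric D → IsUnit D)
    (h : A ∣ conjReflect A) : IsUnit A := by
  obtain ⟨u, hu, hsymm⟩ := exists_conjSymmetric_of_dvd_conjReflect hA h
  have hCu : IsUnit (C u : MvPolynomial (Fin d) ℂ) := (isUnit_iff_ne_zero.2 hu).map C
  exact isUnit_of_mul_isUnit_right (hP _ ((hCu.mul_left_dvd).2 hAP) hsymm)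

theorem dvd_conjReflect_of_mul_eq {d : ℕ} {A B : MvPolynomial (Fin d) ℂ} {k l : Fin d →₀ ℕ}
    (hAB : IsRelPrime A B) (hA : ∀ i, ¬ X i ∣ A)
    (h : A * conjReflect B * monomial k 1 = B * conjReflect A * monomial l 1) :
    A ∣ conjReflect A := by
  have h1 : A ∣ B * conjReflect A * monomial l 1 := h ▸ ⟨conjReflect B * monomial k 1, by ring⟩
  exact hAB.dvd_of_dvd_mul_left ((isRelPrime_monomial hA l).dvd_of_dvd_mul_right h1)

/-- **Uniqueness of magnitude retrieval.** Let `x, y` be nonzero finitely supported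
sequences whose generating polynomials `X, Y` have no non-unit conjugate symmetric
divisor (in particular trivial linear phase factors are excluded). If
`X(ω)·conj(Y(ω)) ∈ ℝ` for every `ω ∈ ℝᵈ` (the tangents of the phases of the Fourier
transforms agree), then `x(n) = β·y(n)` for all `n`, for some real `β`. -/
theorem uniqueness_magnitude_retrieval
    (d : ℕ) (hd : 1 ≤ d)
    (X Y : MvPolynomial (Fin d) ℂ)
    (hX0 : X ≠ 0) (hY0 : Y ≠ 0)
    (hX : ∀ D : MvPolynomial (Fin d) ℂ, D ∣ X → ConjSymmetric D → IsUnit D)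
    (hY : ∀ D : MvPolynomial (Fin d) ℂ, D ∣ Y → ConjSymmetric D → IsUnit D)
    (hreal : ∀ ω : Fin d → ℝ,
      (MvPolynomial.eval
          (fun j => Complex.exp (-(2 * Real.pi * Complex.I) * (ω j : ℂ))) X *
        (starRingEnd ℂ)
          (MvPolynomial.eval
            (fun j => Complex.exp (-(2 * Real.pi * Complex.I) * (ω j : ℂ))) Y)).im
        = 0) :
    ∃ β : ℝ, ∀ n : Fin d →₀ ℕ,
      MvPolynomial.coeff n X = (β : ℂ) * MvPolynomial.coeff n Y := by
  have htorus : ∀ w : Fin d → ℂ, (∀ j, ‖w j‖ = 1) →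
      (starRingEnd ℂ) (eval w X * (starRingEnd ℂ) (eval w Y)) =
        eval w X * (starRingEnd ℂ) (eval w Y) := fun w hw => by
    choose t ht using fun j => exists_exp_eq_of_norm_eq_one (hw j)
    have h := hreal t
    rw [funext ht] at h
    exact Complex.conj_eq_iff_im.2 h
  have hnX : ∀ {A P : MvPolynomial (Fin d) ℂ}, A ∣ P →
      (∀ D : MvPolynomial (Fin d) ℂ, D ∣ P → ConjSymmetric D → IsUnit D) →
      ∀ i, ¬ MvPolynomial.X i ∣ A := fun hAP hP i hi =>
    X_prime.not_isUnit (hP _ (hi.trans hAP) (conjSymmetric_X i))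
  obtain ⟨A, B, G, hAB, rfl, rfl⟩ := UniqueFactorizationMonoid.exists_reduced_factors X hX0 Y
  have hG := left_ne_zero_of_mul hX0
  have hA := right_ne_zero_of_mul hX0
  have hB := right_ne_zero_of_mul hY0
  have hkey : A * conjReflect B * monomial (multidegree A) 1 =
      B * conjReflect A * monomial (multidegree B) 1 := by
    refine mul_left_cancel₀ (mul_ne_zero hG (conjReflect_ne_zero hG)) ?_
    refine eq_of_eval_torus_eq fun w hw => ?_
    have h := htorus w hw
    simp only [map_mul, eval_conjReflect _ hw, Complex.conj_conj] at h ⊢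
    linear_combination (-(eval w (monomial (multidegree G) 1) *
      eval w (monomial (multidegree A) 1) * eval w (monomial (multidegree B) 1))) * h
  have hAu : IsUnit A := isUnit_of_dvd_conjReflect hA (dvd_mul_left A G) hX
    (dvd_conjReflect_of_mul_eq hAB (hnX (dvd_mul_left A G) hX) hkey)
  have hBu : IsUnit B := isUnit_of_dvd_conjReflect hB (dvd_mul_left B G) hY
    (dvd_conjReflect_of_mul_eq hAB.symm (hnX (dvd_mul_left B G) hY) hkey.symm)
  obtain ⟨a, ha, rfl⟩ := isUnit_iff_eq_C_of_isReduced.1 hAu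
  obtain ⟨b, hb, rfl⟩ := isUnit_iff_eq_C_of_isReduced.1 hBu
  have hb0 := hb.ne_zero
  obtain ⟨w, hw, hGw⟩ : ∃ w : Fin d → ℂ, (∀ j, ‖w j‖ = 1) ∧ eval w G ≠ 0 := by
    by_contra! h
    exact hG (eq_of_eval_torus_eq fun w hw => by rw [h w hw, map_zero])
  have hab : (starRingEnd ℂ) a * b = a * (starRingEnd ℂ) b := by
    have h := htorus w hw
    simp only [map_mul, eval_C, Complex.conj_conj] at h
    have hGw' : (starRingEnd ℂ) (eval w G) ≠ 0 := by simpa using hGw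
    refine mul_left_cancel₀ (mul_ne_zero hGw hGw') ?_
    linear_combination h
  obtain ⟨β, hβ⟩ : ∃ β : ℝ, a / b = β := by
    refine Complex.conj_eq_iff_real.1 ?_
    have hb' : (starRingEnd ℂ) b ≠ 0 := by simpa using hb0
    rw [map_div₀, div_eq_div_iff hb' hb0, hab]
  refine ⟨β, fun n => ?_⟩
  rw [mul_comm G, mul_comm G, coeff_C_mul, coeff_C_mul, ← hβ]
  field_simp
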